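/- Let n ≥ 5 and 3 ≤ i ≤ n-1. Then Σ_{σ ∈ D_n^{{0,i}}} (-1)^{ℓ(σ)} x^{L(σ)} = ∏_{j=4}^{n} (1 + (-1)^{j-1} x^{⌊j/2⌋})^2. -/

import Mathlib

open Polynomial Finset

namespace OddLength

/-- A signed permutation of degree `n`, encoded as an underlying permutation of
`Fin n` together with a sign vector. -/
abbrev SP (n : ℕ) := Equiv.Perm (Fin n) × (Fin n → Bool)

/-- The one-line value `σ(i)` of a signed permutation, for `i ∈ [1,n]` (and `0` elsewhere). -/
def sval {n : ℕ} (σ : SP n) (i : ℕ) : ℤ :=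
  if h : 1 ≤ i ∧ i ≤ n then
    (if σ.2 ⟨i - 1, by omega⟩ then (-1 : ℤ) else 1) *
      (((σ.1 ⟨i - 1, by omega⟩ : Fin n) : ℕ) + 1 : ℤ)
  else 0

/-- A signed permutation is *even* (lies in the Weyl group `D_n`) if it has an even
number of negative entries in its one-line notation. -/
def IsEvenSP {n : ℕ} (σ : SP n) : Prop :=
  Even ((Finset.univ.filter (fun i => σ.2 i = true)).card)

instance {n : ℕ} (σ : SP n) : Decidable (IsEvenSP σ) := by
  unfold IsEvenSP; infer_instance

/-- Pairs `1 ≤ i < j ≤ n` of positions. -/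
def pairs (n : ℕ) : Finset (ℕ × ℕ) :=
  (Finset.Icc 1 n ×ˢ Finset.Icc 1 n).filter (fun p => p.1 < p.2)

/-- Number of inversions. -/
def invSP {n : ℕ} (σ : SP n) : ℕ :=
  ((pairs n).filter (fun p => sval σ p.2 < sval σ p.1)).card

/-- Number of negative sum pairs. -/
def nspSP {n : ℕ} (σ : SP n) : ℕ :=
  ((pairs n).filter (fun p => sval σ p.1 + sval σ p.2 < 0)).card

/-- Number of odd inversions (positions of different parity). -/
def oinvSP {n : ℕ} (σ : SP n) : ℕ :=
  ((pairs n).filter (fun p => sval σ p.2 < sval σ p.1 ∧ p.1 % 2 ≠ p.2 % 2)).card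

/-- Number of odd negative sum pairs (positions of different parity). -/
def onspSP {n : ℕ} (σ : SP n) : ℕ :=
  ((pairs n).filter (fun p => sval σ p.1 + sval σ p.2 < 0 ∧ p.1 % 2 ≠ p.2 % 2)).card

/-- The type-`D` Coxeter length `ℓ(σ) = inv(σ) + nsp(σ)`. -/
def ellD {n : ℕ} (σ : SP n) : ℕ := invSP σ + nspSP σ

/-- The type-`D` odd length `L(σ) = oinv(σ) + onsp(σ)`. -/
def LD {n : ℕ} (σ : SP n) : ℕ := oinvSP σ + onspSP σ

/-- The descent value at position `i`, with the type-`D` convention `σ(0) := -σ(2)`. -/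
def dval {n : ℕ} (σ : SP n) (i : ℕ) : ℤ := if i = 0 then -sval σ 2 else sval σ i

/-- Membership in the parabolic quotient `D_n^I`: `σ(i) < σ(i+1)` for all `i ∈ I`,
with the convention `σ(0) = -σ(2)`. -/
def InQuot {n : ℕ} (σ : SP n) (I : Finset ℕ) : Prop :=
  ∀ i ∈ I, dval σ i < dval σ (i + 1)

instance {n : ℕ} (σ : SP n) (I : Finset ℕ) : Decidable (InQuot σ I) := by
  unfold InQuot; infer_instance

/-- `σ` is ascending: `σ(1) < σ(2) < ⋯ < σ(n)`. -/
def Ascending {n : ℕ} (σ : SP n) : Prop :=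
  ∀ i, 1 ≤ i → i < n → sval σ i < sval σ (i + 1)

/-- `σ` is a chessboard element: `σ(i) ≢ σ(i+1) (mod 2)` for all `i ∈ [n-1]`. -/
def Chessboard {n : ℕ} (σ : SP n) : Prop :=
  ∀ i ∈ Finset.Icc 1 (n - 1), sval σ i % 2 ≠ sval σ (i + 1) % 2

instance {n : ℕ} (σ : SP n) : Decidable (Chessboard σ) := by
  unfold Chessboard; infer_instance

/-- The sign-twisted generating function of the odd length over `D_n^I`. -/
noncomputable def genD (n : ℕ) (I : Finset ℕ) : Polynomial ℤ :=
  ∑ σ ∈ Finset.univ.filter (fun σ : SP n => IsEvenSP σ ∧ InQuot σ I),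
    (-1 : Polynomial ℤ) ^ ellD σ * X ^ LD σ



/-! ### Weights of words -/

/-- 0-based one-line word. -/
def vv {n : ℕ} (σ : SP n) (j : ℕ) : ℤ := sval σ (j + 1)

def cnt (x y : ℤ) : ℕ := (if y < x then 1 else 0) + (if x + y < 0 then 1 else 0)

def ell (n : ℕ) (v : ℕ → ℤ) : ℕ :=
  ∑ k ∈ range n, ∑ j ∈ range k, cnt (v j) (v k)

def oell (n : ℕ) (v : ℕ → ℤ) : ℕ :=
  ∑ k ∈ range n, ∑ j ∈ range k, if j % 2 ≠ k % 2 then cnt (v j) (v k) else 0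

/-- pair weight -/
noncomputable def hh (x y : ℤ) (j k : ℕ) : Polynomial ℤ :=
  (if j % 2 ≠ k % 2 then -X else -1) ^ cnt x y

noncomputable def wt (n : ℕ) (v : ℕ → ℤ) : Polynomial ℤ :=
  ∏ k ∈ range n, ∏ j ∈ range k, hh (v j) (v k) j k

def insF (p : ℕ) (x : ℤ) (v : ℕ → ℤ) (j : ℕ) : ℤ :=
  if j < p then v j else if j = p then x else v (j - 1)

def allF : ℕ → List (ℕ → ℤ)
  | 0 => [fun _ => 0]
  | n + 1 => (List.range (n + 1)).flatMap fun p =>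
      [true, false].flatMap fun b => (allF n).map (insF p (if b then -(n + 1 : ℤ) else (n + 1 : ℤ)))

def addAt : ℕ → ℤ → List ℤ → List ℤ
  | 0, s, [] => [s]
  | 0, s, a :: t => (a + s) :: t
  | k + 1, s, [] => 0 :: addAt k s []
  | k + 1, s, a :: t => a :: addAt k s t

def accum (n : ℕ) (l : List (ℕ → ℤ)) : List ℤ :=
  l.foldr (fun v acc => if v 1 < v 2 ∧ v 3 < v 4 then
    addAt (oell n v) (if ell n v % 2 = 0 then 1 else -1) acc else acc) []

def insN (p x : ℕ) (v : ℕ → ℕ) (j : ℕ) : ℕ :=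
  bif Nat.blt j p then v j else bif Nat.beq j p then x else v (j - 1)

def allN : ℕ → List (ℕ → ℕ)
  | 0 => [fun _ => 10]
  | n + 1 => (List.range (n + 1)).flatMap fun p =>
      [true, false].flatMap fun b => (allN n).map (insN p (bif b then 9 - n else 11 + n))

def cntN (x y : ℕ) : ℕ := (bif Nat.blt y x then 1 else 0) + (bif Nat.blt (x + y) 20 then 1 else 0)

def accN (l : List (ℕ → ℕ)) : List ℤ :=
  l.foldr (fun v acc => bif Nat.blt (v 1) (v 2) && Nat.blt (v 3) (v 4) then
    (fun o e => addAt o (bif Nat.beq ((o + e) % 2) 0 then 1 else -1) acc)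
     (cntN (v 0) (v 1) + cntN (v 1) (v 2) + cntN (v 0) (v 3) + cntN (v 2) (v 3) + cntN (v 1) (v 4) + cntN (v 3) (v 4))
     (cntN (v 0) (v 2) + cntN (v 1) (v 3) + cntN (v 0) (v 4) + cntN (v 2) (v 4)) else acc) []
theorem bN : accN (allN 5) = [2, 0, 0, 0, -4, 0, 0, 0, 2, 0, 0] := by decide +kernel

/-- decoding of shifted natural words -/
def dec (v : ℕ → ℕ) (j : ℕ) : ℤ := (v j : ℤ) - 10

theorem blt_dec (a b : ℕ) : Nat.blt a b = decide (a < b) := by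
  rw [Bool.eq_iff_iff, Nat.blt_eq]; simp

theorem beq_dec (a b : ℕ) : Nat.beq a b = decide (a = b) := by
  rw [Bool.eq_iff_iff, Nat.beq_eq]; simp

theorem dec_insN (p x : ℕ) (v : ℕ → ℕ) : dec (insN p x v) = insF p ((x : ℤ) - 10) (dec v) := by
  funext j
  unfold dec insN insF
  by_cases h1 : j < p
  · simp [blt_dec, h1]
  · by_cases h2 : j = p
    · simp [blt_dec, beq_dec, h2]
    · simp [blt_dec, beq_dec, h1, h2]

theorem allF_eq (n : ℕ) (hn : n ≤ 9) : allF n = (allN n).map dec := by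
  induction n with
  | zero => simp [allF, allN]; rfl
  | succ n ih =>
    simp only [allF, allN, List.map_flatMap, List.map_map, ih (by omega)]
    congr 1
    funext p
    congr 1
    funext b
    congr 1
    funext v
    simp only [Function.comp_apply, dec_insN]
    congr 1
    cases b
    · simp; ring
    · simp; omega

theorem cnt_dec (x y : ℕ) : cnt ((x : ℤ) - 10) ((y : ℤ) - 10) = cntN x y := by
  unfold cnt cntN
  congr 1
  · by_cases h : y < x <;> simp [blt_dec, h]
  · by_cases h : x + y < 20
    · rw [if_pos (by omega)]; simp [blt_dec, h]
    · rw [if_neg (by omega)]; simp [blt_dec, h]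

theorem accum_dec (l : List (ℕ → ℕ)) : accum 5 (l.map dec) = accN l := by
  induction l with
  | nil => rfl
  | cons v l ih =>
    have ih' := ih
    unfold accum at ih
    unfold accum accN
    rw [List.map_cons, List.foldr_cons, List.foldr_cons, ih]
    unfold accN
    have ho : oell 5 (dec v) = cntN (v 0) (v 1) + cntN (v 1) (v 2) + cntN (v 0) (v 3) +
        cntN (v 2) (v 3) + cntN (v 1) (v 4) + cntN (v 3) (v 4) := by
      simp [oell, Finset.sum_range_succ, dec, cnt_dec]; ring
    have he : ell 5 (dec v) = cntN (v 0) (v 1) + cntN (v 1) (v 2) + cntN (v 0) (v 3) +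
        cntN (v 2) (v 3) + cntN (v 1) (v 4) + cntN (v 3) (v 4) + (cntN (v 0) (v 2) +
        cntN (v 1) (v 3) + cntN (v 0) (v 4) + cntN (v 2) (v 4)) := by
      simp [ell, Finset.sum_range_succ, dec, cnt_dec]; ring
    have hb : ∀ m : ℕ, (bif Nat.beq (m % 2) 0 then (1 : ℤ) else -1) =
        if m % 2 = 0 then 1 else -1 := by
      intro m
      rcases Nat.mod_two_eq_zero_or_one m with h | h <;> rw [h] <;> rfl
    simp only [ho, he, hb]
    by_cases h1 : v 1 < v 2 <;> by_cases h2 : v 3 < v 4 <;> simp [blt_dec, dec, h1, h2]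

theorem base_comp : accum 5 (allF 5) = [2, 0, 0, 0, -4, 0, 0, 0, 2, 0, 0] := by
  rw [allF_eq 5 (by omega), accum_dec, bN]


theorem wt_eq (n : ℕ) (v : ℕ → ℤ) :
    wt n v = (-1 : Polynomial ℤ) ^ ell n v * X ^ oell n v := by
  unfold wt ell oell
  rw [← Finset.prod_pow_eq_pow_sum, ← Finset.prod_pow_eq_pow_sum, ← Finset.prod_mul_distrib]
  refine Finset.prod_congr rfl fun k _ => ?_
  rw [← Finset.prod_pow_eq_pow_sum, ← Finset.prod_pow_eq_pow_sum, ← Finset.prod_mul_distrib]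
  refine Finset.prod_congr rfl fun j _ => ?_
  unfold hh
  split_ifs
  · rw [neg_pow]
  · simp

/-! ### Distance two swaps -/

theorem hh_par (x y : ℤ) (j k j' k' : ℕ) (hj : j % 2 = j' % 2) (hk : k % 2 = k' % 2) :
    hh x y j k = hh x y j' k' := by
  unfold hh; rw [hj, hk]

theorem prod3 (f : ℕ → Polynomial ℤ) (a t : ℕ) :
    ∏ j ∈ range (a + 3 + t), f j =
      (∏ j ∈ range a, f j) * f a * f (a + 1) * f (a + 2) * ∏ s ∈ range t, f (a + 3 + s) := by
  rw [Finset.prod_range_add, Finset.prod_range_succ, Finset.prod_range_succ,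
    Finset.prod_range_succ]

theorem cnt_swap (x y z : ℤ) (hxz : x ≠ z) (hs : x < y ↔ z < y) (hxy : x ≠ y) (hzy : z ≠ y) :
    cnt z y + cnt y x = cnt x y + cnt y z ∧
      (cnt z x = cnt x z + 1 ∨ cnt x z = cnt z x + 1) := by
  unfold cnt
  grind

theorem wt_swap (n a : ℕ) (v : ℕ → ℤ) (ha : a + 2 < n)
    (h02 : v a ≠ v (a + 2)) (h01 : v a ≠ v (a + 1)) (h21 : v (a + 2) ≠ v (a + 1))
    (hs : v a < v (a + 1) ↔ v (a + 2) < v (a + 1)) :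
    wt n (v ∘ Equiv.swap a (a + 2)) = - wt n v := by
  obtain ⟨t, rfl⟩ : ∃ t, n = a + 3 + t := ⟨n - (a + 3), by omega⟩
  set v' := v ∘ Equiv.swap a (a + 2) with hv'
  have e0 : v' a = v (a + 2) := by simp [hv']
  have e2 : v' (a + 2) = v a := by simp [hv']
  have eo : ∀ j, j ≠ a → j ≠ a + 2 → v' j = v j := fun j h1 h2 => by
    simp [hv', Equiv.swap_apply_of_ne_of_ne h1 h2]
  have e1 : v' (a + 1) = v (a + 1) := eo _ (by omega) (by omega)
  have el : ∀ (y : ℤ) (k : ℕ), ∏ j ∈ range a, hh (v' j) y j k = ∏ j ∈ range a, hh (v j) y j k := by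
    intro y k
    refine Finset.prod_congr rfl fun j hj => ?_
    rw [Finset.mem_range] at hj
    rw [eo j (by omega) (by omega)]
  have ep : ∀ (y : ℤ), ∏ j ∈ range a, hh (v j) y j (a + 2) = ∏ j ∈ range a, hh (v j) y j a := by
    intro y
    exact Finset.prod_congr rfl fun j hj => hh_par _ _ _ _ _ _ rfl (by omega)
  unfold wt
  rw [prod3, prod3]
  have r1 : ∏ k ∈ range a, ∏ j ∈ range k, hh (v' j) (v' k) j k =
      ∏ k ∈ range a, ∏ j ∈ range k, hh (v j) (v k) j k := by
    refine Finset.prod_congr rfl fun k hk => Finset.prod_congr rfl fun j hj => ?_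
    rw [Finset.mem_range] at hk hj
    rw [eo j (by omega) (by omega), eo k (by omega) (by omega)]
  have r2 : ∏ s ∈ range t, ∏ j ∈ range (a + 3 + s), hh (v' j) (v' (a + 3 + s)) j (a + 3 + s) =
      ∏ s ∈ range t, ∏ j ∈ range (a + 3 + s), hh (v j) (v (a + 3 + s)) j (a + 3 + s) := by
    refine Finset.prod_congr rfl fun s hs => ?_
    rw [eo (a + 3 + s) (by omega) (by omega), prod3, prod3, el, e0, e1, e2]
    have : ∏ x ∈ range s, hh (v' (a + 3 + x)) (v (a + 3 + s)) (a + 3 + x) (a + 3 + s) =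
        ∏ x ∈ range s, hh (v (a + 3 + x)) (v (a + 3 + s)) (a + 3 + x) (a + 3 + s) :=
      Finset.prod_congr rfl fun x _ => by rw [eo (a + 3 + x) (by omega) (by omega)]
    rw [this, hh_par (v (a + 2)) _ a (a + 3 + s) (a + 2) (a + 3 + s) (by omega) rfl,
      hh_par (v a) _ (a + 2) (a + 3 + s) a (a + 3 + s) (by omega) rfl]
    ring
  rw [r1, r2]
  have r3 : hh (v (a + 2)) (v (a + 1)) a (a + 1) * hh (v (a + 2)) (v a) a (a + 2) *
      hh (v (a + 1)) (v a) (a + 1) (a + 2) = -(hh (v a) (v (a + 1)) a (a + 1) *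
      hh (v a) (v (a + 2)) a (a + 2) * hh (v (a + 1)) (v (a + 2)) (a + 1) (a + 2)) := by
    obtain ⟨c1, c2⟩ := cnt_swap _ _ _ h02 hs h01 h21
    have p1 : a % 2 ≠ (a + 1) % 2 := by omega
    have p2 : ¬ (a % 2 ≠ (a + 2) % 2) := by omega
    have p3 : (a + 1) % 2 ≠ (a + 2) % 2 := by omega
    unfold hh
    rw [if_pos p1, if_neg p2, if_pos p3]
    have : (-X : Polynomial ℤ) ^ cnt (v (a + 2)) (v (a + 1)) * (-X) ^ cnt (v (a + 1)) (v a) =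
      (-X) ^ cnt (v a) (v (a + 1)) * (-X) ^ cnt (v (a + 1)) (v (a + 2)) := by
      rw [← pow_add, ← pow_add, c1]
    have h2 : (-1 : Polynomial ℤ) ^ cnt (v (a + 2)) (v a) = - (-1) ^ cnt (v a) (v (a + 2)) := by
      rcases c2 with c | c <;> rw [c, pow_succ] <;> ring
    rw [h2]
    linear_combination (-(-1 : Polynomial ℤ) ^ cnt (v a) (v (a + 2))) * this
  have q : ∀ (f : ℕ → Polynomial ℤ), ∏ j ∈ range (a + 1), f j = (∏ j ∈ range a, f j) * f a :=
    fun f => Finset.prod_range_succ _ _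
  have q' : ∀ (f : ℕ → Polynomial ℤ),
      ∏ j ∈ range (a + 2), f j = (∏ j ∈ range a, f j) * f a * f (a + 1) :=
    fun f => by rw [Finset.prod_range_succ, Finset.prod_range_succ]
  simp only [q, q', el, e0, e1, e2, ep]
  linear_combination ((∏ k ∈ range a, ∏ j ∈ range k, hh (v j) (v k) j k) *
    (∏ j ∈ range a, hh (v j) (v (a + 2)) j a) * (∏ j ∈ range a, hh (v j) (v (a + 1)) j (a + 1)) *
    (∏ j ∈ range a, hh (v j) (v a) j a) *
    ∏ s ∈ range t, ∏ j ∈ range (a + 3 + s), hh (v j) (v (a + 3 + s)) j (a + 3 + s)) * r3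

/-! ### Properties of `vv` -/

theorem vv_lt {n : ℕ} (σ : SP n) (j : ℕ) (h : j < n) :
    vv σ j = (if σ.2 ⟨j, h⟩ then (-1 : ℤ) else 1) * (((σ.1 ⟨j, h⟩ : Fin n) : ℕ) + 1 : ℤ) := by
  unfold vv sval
  rw [dif_pos ⟨by omega, by omega⟩]
  rfl

theorem vv_ge {n : ℕ} (σ : SP n) (j : ℕ) (h : n ≤ j) : vv σ j = 0 := by
  unfold vv sval
  rw [dif_neg (by omega)]

theorem vv_abs {n : ℕ} (σ : SP n) (j : ℕ) (h : j < n) :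
    |vv σ j| = (((σ.1 ⟨j, h⟩ : Fin n) : ℕ) + 1 : ℤ) := by
  rw [vv_lt σ j h, abs_mul]
  have : |(if σ.2 ⟨j, h⟩ then (-1 : ℤ) else 1)| = 1 := by split_ifs <;> simp
  rw [this, one_mul, abs_of_nonneg (by positivity)]

theorem vv_abs_ne {n : ℕ} (σ : SP n) (j k : ℕ) (hj : j < n) (hk : k < n) (h : j ≠ k) :
    |vv σ j| ≠ |vv σ k| := by
  rw [vv_abs σ j hj, vv_abs σ k hk]
  intro e
  have : σ.1 ⟨j, hj⟩ = σ.1 ⟨k, hk⟩ := Fin.ext (by omega)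
  have := σ.1.injective this
  simp at this
  exact h this

theorem vv_ne {n : ℕ} (σ : SP n) (j k : ℕ) (hj : j < n) (hk : k < n) (h : j ≠ k) :
    vv σ j ≠ vv σ k := fun e => vv_abs_ne σ j k hj hk h (by rw [e])

theorem vv_abs_le {n : ℕ} (σ : SP n) (j : ℕ) (h : j < n) : |vv σ j| ≤ n := by
  rw [vv_abs σ j h]
  have := (σ.1 ⟨j, h⟩).2
  omega

/-- swap positions -/
def swapSP {n : ℕ} (a b : Fin n) : SP n ≃ SP n where
  toFun σ := (σ.1 * Equiv.swap a b, σ.2 ∘ Equiv.swap a b)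
  invFun σ := (σ.1 * Equiv.swap a b, σ.2 ∘ Equiv.swap a b)
  left_inv σ := by ext x <;> simp [mul_assoc]
  right_inv σ := by ext x <;> simp [mul_assoc]

theorem vv_swap {n : ℕ} (σ : SP n) (a b : Fin n) :
    vv (swapSP a b σ) = vv σ ∘ Equiv.swap (a : ℕ) (b : ℕ) := by
  funext j
  by_cases h : j < n
  · have e : ((Equiv.swap a b ⟨j, h⟩ : Fin n) : ℕ) = Equiv.swap (a : ℕ) (b : ℕ) j := by
      rw [Equiv.swap_apply_def, Equiv.swap_apply_def]
      split_ifs <;> simp_all [Fin.ext_iff]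
    have h' : Equiv.swap (a : ℕ) (b : ℕ) j < n := by rw [← e]; exact Fin.is_lt _
    have e' : Equiv.swap a b ⟨j, h⟩ = ⟨Equiv.swap (a : ℕ) (b : ℕ) j, h'⟩ := Fin.ext e
    rw [Function.comp_apply, vv_lt _ _ h, vv_lt _ _ h']
    simp only [swapSP, Equiv.coe_fn_mk, Equiv.Perm.coe_mul, Function.comp_apply, e']
  · have : Equiv.swap (a : ℕ) (b : ℕ) j = j :=
      Equiv.swap_apply_of_ne_of_ne (by omega) (by omega)
    rw [Function.comp_apply, this, vv_ge _ _ (by omega), vv_ge _ _ (by omega)]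

/-! ### Sums -/

open Classical in
noncomputable def SS (n : ℕ) (P : (ℕ → ℤ) → Prop) : Polynomial ℤ :=
  ∑ σ : SP n, if P (vv σ) then wt n (vv σ) else 0

theorem SS_congr (n : ℕ) (P Q : (ℕ → ℤ) → Prop) (h : ∀ σ : SP n, P (vv σ) ↔ Q (vv σ)) :
    SS n P = SS n Q := by
  unfold SS
  refine Finset.sum_congr rfl fun σ _ => ?_
  by_cases hp : P (vv σ)
  · rw [if_pos hp, if_pos ((h σ).1 hp)]
  · rw [if_neg hp, if_neg (fun h' => hp ((h σ).2 h'))]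

theorem SS_split (n : ℕ) (P Q : (ℕ → ℤ) → Prop) :
    SS n P = SS n (fun v => P v ∧ Q v) + SS n (fun v => P v ∧ ¬ Q v) := by
  unfold SS
  rw [← Finset.sum_add_distrib]
  refine Finset.sum_congr rfl fun σ _ => ?_
  by_cases h1 : P (vv σ) <;> by_cases h2 : Q (vv σ) <;> simp [h1, h2]

theorem SS_zero (n a : ℕ) (ha : a + 2 < n) (P : (ℕ → ℤ) → Prop)
    (hP : ∀ σ : SP n, P (vv σ) ↔ P (vv σ ∘ Equiv.swap a (a + 2)))
    (hs : ∀ σ : SP n, P (vv σ) → (vv σ a < vv σ (a + 1) ↔ vv σ (a + 2) < vv σ (a + 1))) :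
    SS n P = 0 := by
  have key : SS n P = - SS n P := by
    conv_lhs => unfold SS
    rw [← Equiv.sum_comp (swapSP (⟨a, by omega⟩ : Fin n) ⟨a + 2, ha⟩)]
    unfold SS
    rw [← Finset.sum_neg_distrib]
    refine Finset.sum_congr rfl fun σ _ => ?_
    rw [vv_swap]
    simp only
    by_cases h : P (vv σ)
    · rw [if_pos h, if_pos ((hP σ).1 h)]
      exact wt_swap n a _ ha (vv_ne σ _ _ (by omega) (by omega) (by omega))
        (vv_ne σ _ _ (by omega) (by omega) (by omega))
        (vv_ne σ _ _ (by omega) (by omega) (by omega)) (hs σ h)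
    · rw [if_neg h, if_neg (fun h' => h ((hP σ).2 h')), neg_zero]
  exact self_eq_neg.mp key

theorem sw0 (v : ℕ → ℤ) (a : ℕ) : (v ∘ Equiv.swap a (a + 2)) a = v (a + 2) := by simp
theorem sw2 (v : ℕ → ℤ) (a : ℕ) : (v ∘ Equiv.swap a (a + 2)) (a + 2) = v a := by simp
theorem swo (v : ℕ → ℤ) (a j : ℕ) (h1 : j ≠ a) (h2 : j ≠ a + 2) :
    (v ∘ Equiv.swap a (a + 2)) j = v j := by simp [Equiv.swap_apply_of_ne_of_ne h1 h2]

/-- shifting a constraint by one -/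
theorem SS_shift (n a : ℕ) (ha : a + 2 < n) (P : (ℕ → ℤ) → Prop)
    (hP : ∀ v, P v ↔ P (v ∘ Equiv.swap a (a + 2))) :
    SS n (fun v => P v ∧ v a < v (a + 1)) = SS n (fun v => P v ∧ v (a + 1) < v (a + 2)) := by
  rw [SS_split n (fun v => P v ∧ v a < v (a + 1)) (fun v => v (a + 1) < v (a + 2)),
    SS_split n (fun v => P v ∧ v (a + 1) < v (a + 2)) (fun v => v a < v (a + 1))]
  have z1 : SS n (fun v => (P v ∧ v a < v (a + 1)) ∧ ¬ v (a + 1) < v (a + 2)) = 0 := by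
    apply SS_zero n a ha
    · intro σ
      have := vv_ne σ a (a + 1) (by omega) (by omega) (by omega)
      have := vv_ne σ (a + 2) (a + 1) (by omega) (by omega) (by omega)
      simp only [sw0, sw2, swo _ a (a + 1) (by omega) (by omega), ← hP]
      grind
    · intro σ
      have := vv_ne σ a (a + 1) (by omega) (by omega) (by omega)
      have := vv_ne σ (a + 2) (a + 1) (by omega) (by omega) (by omega)
      grind
  have z2 : SS n (fun v => (P v ∧ v (a + 1) < v (a + 2)) ∧ ¬ v a < v (a + 1)) = 0 := by
    apply SS_zero n a ha
    · intro σ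
      have := vv_ne σ a (a + 1) (by omega) (by omega) (by omega)
      have := vv_ne σ (a + 2) (a + 1) (by omega) (by omega) (by omega)
      simp only [sw0, sw2, swo _ a (a + 1) (by omega) (by omega), ← hP]
      grind
    · intro σ
      have := vv_ne σ a (a + 1) (by omega) (by omega) (by omega)
      have := vv_ne σ (a + 2) (a + 1) (by omega) (by omega) (by omega)
      grind
  rw [z1, z2]
  congr 1
  apply SS_congr
  intro σ
  tauto

/-! ### Middle positions of the largest value contribute zero -/

theorem SS_mid (n p : ℕ) (hp : p + 2 < n) (P : (ℕ → ℤ) → Prop)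
    (hP : ∀ σ : SP n, |vv σ (p + 1)| = n → P (vv σ) → P (vv σ ∘ Equiv.swap p (p + 2))) :
    SS n (fun v => |v (p + 1)| = n ∧ P v) = 0 := by
  apply SS_zero n p hp
  · intro σ
    rw [swo _ p (p + 1) (by omega) (by omega)]
    constructor
    · rintro ⟨h1, h2⟩
      exact ⟨h1, hP σ h1 h2⟩
    · rintro ⟨h1, h2⟩
      refine ⟨h1, ?_⟩
      have := vv_swap σ (⟨p, by omega⟩ : Fin n) ⟨p + 2, hp⟩
      simp only at this
      have h3 := hP (swapSP (⟨p, by omega⟩ : Fin n) ⟨p + 2, hp⟩ σ)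
      rw [this, swo _ p (p + 1) (by omega) (by omega)] at h3
      have h4 := h3 h1 h2
      have e : (vv σ ∘ Equiv.swap p (p + 2)) ∘ Equiv.swap p (p + 2) = vv σ := by
        funext j; simp
      rwa [e] at h4
  · rintro σ ⟨h1, -⟩
    have a0 := vv_abs_le σ p (by omega)
    have a2 := vv_abs_le σ (p + 2) (by omega)
    have n0 := vv_ne σ p (p + 1) (by omega) (by omega) (by omega)
    have n2 := vv_ne σ (p + 2) (p + 1) (by omega) (by omega) (by omega)
    grind

theorem mid_zero (n p : ℕ) (hn : 6 ≤ n) (hp0 : 0 < p) (hp : p + 1 < n) :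
    SS n (fun v => |v p| = n ∧ v 1 < v 2 ∧ v 3 < v 4) = 0 := by
  have sh1 : ∀ q, q ≠ 0 → q ≠ 2 →
      SS n (fun v => |v q| = n ∧ v 1 < v 2 ∧ v 3 < v 4) =
        SS n (fun v => |v q| = n ∧ v 0 < v 1 ∧ v 3 < v 4) := by
    intro q h0 h2
    have := SS_shift n 0 (by omega) (fun v => |v q| = n ∧ v 3 < v 4) (by
      intro v
      rw [swo v 0 q h0 h2, swo v 0 3 (by omega) (by omega), swo v 0 4 (by omega) (by omega)])
    rw [SS_congr n _ (fun v => (|v q| = n ∧ v 3 < v 4) ∧ v (0 + 1) < v (0 + 2)), ← this]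
    · apply SS_congr; intro σ; simp only [Nat.zero_add]; tauto
    · intro σ; simp only [Nat.zero_add]; tauto
  by_cases h1 : p = 1
  · subst h1
    apply SS_mid n 0 (by omega)
    rintro σ hz ⟨c1, c3⟩
    rw [swo _ 0 3 (by omega) (by omega), swo _ 0 4 (by omega) (by omega),
      swo _ 0 1 (by omega) (by omega), show (2 : ℕ) = 0 + 2 from rfl, sw2]
    refine ⟨?_, c3⟩
    have a0 := vv_abs_le σ 0 (by omega)
    have a2 := vv_abs_le σ 2 (by omega)
    have n0 := vv_ne σ 0 1 (by omega) (by omega) (by omega)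
    grind
  by_cases h2 : p = 2
  · subst h2
    have := SS_shift n 3 (by omega) (fun v => |v 2| = n ∧ v 1 < v 2) (by
      intro v
      rw [swo v 3 2 (by omega) (by omega), swo v 3 1 (by omega) (by omega)])
    rw [SS_congr n _ (fun v => (|v 2| = n ∧ v 1 < v 2) ∧ v 3 < v (3 + 1)), this]
    · rw [SS_congr n _ (fun v => |v (1 + 1)| = n ∧ v 1 < v 2 ∧ v 4 < v 5)]
      · apply SS_mid n 1 (by omega)
        rintro σ hz ⟨c1, c3⟩
        rw [swo _ 1 2 (by omega) (by omega), swo _ 1 4 (by omega) (by omega),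
          swo _ 1 5 (by omega) (by omega), sw0]
        refine ⟨?_, c3⟩
        have a0 := vv_abs_le σ 1 (by omega)
        have a2 := vv_abs_le σ 3 (by omega)
        have n0 := vv_ne σ 3 2 (by omega) (by omega) (by omega)
        grind
      · intro σ; simp only [Nat.reduceAdd]; tauto
    · intro σ; simp only [Nat.reduceAdd]; tauto
  by_cases h3 : p = 3
  · subst h3
    rw [sh1 3 (by omega) (by omega)]
    apply SS_mid n 2 (by omega)
    rintro σ hz ⟨c1, c3⟩
    rw [swo _ 2 0 (by omega) (by omega), swo _ 2 1 (by omega) (by omega),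
      swo _ 2 3 (by omega) (by omega), show (4 : ℕ) = 2 + 2 from rfl, sw2]
    refine ⟨c1, ?_⟩
    have a0 := vv_abs_le σ 2 (by omega)
    have a2 := vv_abs_le σ 4 (by omega)
    have n0 := vv_ne σ 2 3 (by omega) (by omega) (by omega)
    grind
  by_cases h4 : p = 4
  · subst h4
    apply SS_mid n 3 (by omega)
    rintro σ hz ⟨c1, c3⟩
    rw [swo _ 3 1 (by omega) (by omega), swo _ 3 2 (by omega) (by omega),
      swo _ 3 4 (by omega) (by omega), sw0]
    refine ⟨c1, ?_⟩
    have a0 := vv_abs_le σ 3 (by omega)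
    have a2 := vv_abs_le σ 5 (by omega)
    have n0 := vv_ne σ 5 4 (by omega) (by omega) (by omega)
    grind
  by_cases h5 : p = 5
  · subst h5
    rw [sh1 5 (by omega) (by omega)]
    have := SS_shift n 2 (by omega) (fun v => |v 5| = n ∧ v 0 < v 1) (by
      intro v
      rw [swo v 2 5 (by omega) (by omega), swo v 2 1 (by omega) (by omega),
        swo v 2 0 (by omega) (by omega)])
    rw [SS_congr n _ (fun v => (|v 5| = n ∧ v 0 < v 1) ∧ v (2 + 1) < v (2 + 2)), ← this]
    · rw [SS_congr n _ (fun v => |v (4 + 1)| = n ∧ v 0 < v 1 ∧ v 2 < v 3)]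
      · apply SS_mid n 4 (by omega)
        rintro σ hz ⟨c1, c3⟩
        rw [swo _ 4 0 (by omega) (by omega), swo _ 4 1 (by omega) (by omega),
          swo _ 4 2 (by omega) (by omega), swo _ 4 3 (by omega) (by omega)]
        exact ⟨c1, c3⟩
      · intro σ; simp only [Nat.reduceAdd]; tauto
    · intro σ; simp only [Nat.reduceAdd]; tauto
  obtain ⟨q, rfl⟩ : ∃ q, p = q + 1 := ⟨p - 1, by omega⟩
  apply SS_mid n q (by omega)
  rintro σ hz ⟨c1, c3⟩
  rw [swo _ q 1 (by omega) (by omega), swo _ q 2 (by omega) (by omega),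
    swo _ q 3 (by omega) (by omega), swo _ q 4 (by omega) (by omega)]
  exact ⟨c1, c3⟩

/-! ### Insertion of the largest value -/

def insSP {n : ℕ} (x : Fin (n + 1) × Bool × SP n) : SP (n + 1) :=
  ((finSuccEquiv' x.1).trans ((Equiv.optionCongr x.2.2.1).trans (finSuccEquiv' (Fin.last n)).symm),
    Fin.insertNth (α := fun _ => Bool) x.1 x.2.1 x.2.2.2)

theorem insSP_fst_self {n : ℕ} (x : Fin (n + 1) × Bool × SP n) :
    (insSP x).1 x.1 = Fin.last n := by simp [insSP]

theorem insSP_fst_succAbove {n : ℕ} (x : Fin (n + 1) × Bool × SP n) (j : Fin n) :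
    (insSP x).1 (x.1.succAbove j) = Fin.castSucc (x.2.2.1 j) := by simp [insSP]

theorem insSP_snd_self {n : ℕ} (x : Fin (n + 1) × Bool × SP n) :
    (insSP x).2 x.1 = x.2.1 := by simp [insSP]

theorem insSP_snd_succAbove {n : ℕ} (x : Fin (n + 1) × Bool × SP n) (j : Fin n) :
    (insSP x).2 (x.1.succAbove j) = x.2.2.2 j := by simp [insSP]

theorem insSP_inj (n : ℕ) : Function.Injective (@insSP n) := by
  intro x y h
  have h1 : x.1 = y.1 := by
    have a := insSP_fst_self x
    have b := insSP_fst_self y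
    rw [h, ← b] at a
    exact (insSP y).1.injective a
  have h2 : x.2.1 = y.2.1 := by
    rw [← insSP_snd_self x, ← insSP_snd_self y, h, h1]
  have h3 : x.2.2.1 = y.2.2.1 := by
    ext j
    have a := insSP_fst_succAbove x j
    have b := insSP_fst_succAbove y j
    rw [h, h1, b] at a
    have := Fin.castSucc_injective _ a
    rw [this]
  have h4 : x.2.2.2 = y.2.2.2 := by
    funext j
    rw [← insSP_snd_succAbove x, ← insSP_snd_succAbove y, h, h1]
  exact Prod.ext h1 (Prod.ext h2 (Prod.ext h3 h4))

theorem insSP_bij (n : ℕ) : Function.Bijective (@insSP n) := by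
  rw [Fintype.bijective_iff_injective_and_card]
  refine ⟨insSP_inj n, ?_⟩
  simp [Fintype.card_perm, Nat.factorial_succ, pow_succ]
  ring

theorem vv_insSP {n : ℕ} (x : Fin (n + 1) × Bool × SP n) :
    vv (insSP x) = insF x.1 (if x.2.1 then -(n + 1 : ℤ) else (n + 1 : ℤ)) (vv x.2.2) := by
  funext j
  by_cases hj : j < n + 1
  · rw [vv_lt _ _ hj]
    have hx := x.1.2
    unfold insF
    by_cases h1 : j < x.1
    · have e : (⟨j, hj⟩ : Fin (n + 1)) = x.1.succAbove ⟨j, by omega⟩ := by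
        rw [Fin.succAbove_of_castSucc_lt _ _ (by simpa [Fin.lt_def] using h1)]; rfl
      rw [e, insSP_fst_succAbove, insSP_snd_succAbove, if_pos h1, vv_lt _ _ (by omega : j < n)]
      rfl
    by_cases h2 : j = x.1
    · have e : (⟨j, hj⟩ : Fin (n + 1)) = x.1 := Fin.ext h2
      rw [e, insSP_fst_self, insSP_snd_self, if_neg h1, if_pos h2]
      split_ifs <;> simp
    · have e : (⟨j, hj⟩ : Fin (n + 1)) = x.1.succAbove ⟨j - 1, by omega⟩ := by
        rw [Fin.succAbove_of_le_castSucc _ _ (by simp [Fin.le_def]; omega)]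
        ext; simp; omega
      rw [e, insSP_fst_succAbove, insSP_snd_succAbove, if_neg h1, if_neg h2,
        vv_lt _ _ (by omega : j - 1 < n)]
      rfl
  · have hx := x.1.2
    rw [vv_ge _ _ (by omega)]
    unfold insF
    rw [if_neg (by omega), if_neg (by omega), vv_ge _ _ (by omega)]

theorem sum_ins (n : ℕ) (f : (ℕ → ℤ) → Polynomial ℤ) :
    ∑ σ : SP (n + 1), f (vv σ) = ∑ p : Fin (n + 1), ∑ b : Bool, ∑ σ : SP n,
      f (insF p (if b then -(n + 1 : ℤ) else (n + 1 : ℤ)) (vv σ)) := by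
  rw [← (Equiv.ofBijective _ (insSP_bij n)).sum_comp, Fintype.sum_prod_type]
  refine Finset.sum_congr rfl fun p _ => ?_
  rw [Fintype.sum_prod_type]
  refine Finset.sum_congr rfl fun b _ => ?_
  refine Finset.sum_congr rfl fun σ _ => ?_
  rw [Equiv.ofBijective_apply, vv_insSP]

/-! ### Base case -/

theorem list_sum_range (n : ℕ) (g : ℕ → Polynomial ℤ) :
    ((List.range n).map g).sum = ∑ i ∈ range n, g i := by
  induction n with
  | zero => simp
  | succ n ih => rw [List.range_succ, List.map_append, List.sum_append, ih, Finset.sum_range_succ]; simp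

theorem sum_allF (n : ℕ) (f : (ℕ → ℤ) → Polynomial ℤ) :
    ∑ σ : SP n, f (vv σ) = ((allF n).map f).sum := by
  induction n generalizing f with
  | zero =>
    simp only [allF, List.map_cons, List.map_nil, List.sum_cons, List.sum_nil, add_zero]
    have : ∀ σ : SP 0, f (vv σ) = f (fun _ => 0) := by
      intro σ
      have e : vv σ = fun _ => 0 := by
        funext j
        exact vv_ge _ _ (by omega)
      rw [e]
    simp [this]
  | succ n ih =>
    rw [sum_ins]
    have : ∀ (p : Fin (n + 1)) (b : Bool), ∑ σ : SP n,
      f (insF p (if b then -(n + 1 : ℤ) else (n + 1 : ℤ)) (vv σ)) = ((allF n).map (fun v =>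
        f (insF p (if b then -(n + 1 : ℤ) else (n + 1 : ℤ)) v))).sum :=
      fun p b => ih (fun v => f (insF p (if b then -(n + 1 : ℤ) else (n + 1 : ℤ)) v))
    simp only [this]
    rw [Fin.sum_univ_eq_sum_range (fun p => ∑ b : Bool, (List.map (fun v => f (insF p
      (if b then -(n + 1 : ℤ) else (n + 1 : ℤ)) v)) (allF n)).sum), ← list_sum_range]
    simp only [allF, List.map_flatMap, List.map_map, Fintype.sum_bool]
    rw [List.flatMap_def, List.sum_flatten, List.map_map]
    congr 2
    funext p
    simp [Function.comp_def]

noncomputable def evl : List ℤ → Polynomial ℤ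
  | [] => 0
  | a :: t => C a + X * evl t

theorem evl_addAt (k : ℕ) (s : ℤ) (l : List ℤ) : evl (addAt k s l) = C s * X ^ k + evl l := by
  induction k generalizing l with
  | zero => cases l <;> simp [addAt, evl]; ring
  | succ k ih => cases l <;> simp [addAt, evl, ih] <;> ring

theorem evl_accum (n : ℕ) (l : List (ℕ → ℤ)) :
    evl (accum n l) = (l.map fun v => if v 1 < v 2 ∧ v 3 < v 4 then wt n v else 0).sum := by
  induction l with
  | nil => rfl
  | cons v l ih =>
    rw [List.map_cons, List.sum_cons, ← ih]
    unfold accum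
    rw [List.foldr_cons]
    split_ifs with h1 h2
    · rw [evl_addAt, wt_eq, (Nat.even_iff.2 h2).neg_one_pow]; simp
    · rw [evl_addAt, wt_eq, (Nat.odd_iff.2 (by omega)).neg_one_pow]; simp
    · simp

theorem base5 : SS 5 (fun v => v 1 < v 2 ∧ v 3 < v 4) = 2 - 4 * X ^ 4 + 2 * X ^ 8 := by
  have : SS 5 (fun v => v 1 < v 2 ∧ v 3 < v 4) = evl (accum 5 (allF 5)) := by
    rw [evl_accum, ← sum_allF]
    unfold SS
    refine Finset.sum_congr rfl fun σ _ => ?_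
    congr
  rw [this, base_comp]
  simp [evl]
  ring

/-! ### Recursion -/

theorem prod_alt (n : ℕ) : ∏ j ∈ range n, (if j % 2 = 0 then (-X : Polynomial ℤ) else -1) =
    (-1) ^ n * X ^ ((n + 1) / 2) := by
  induction n with
  | zero => simp
  | succ n ih =>
    rw [Finset.prod_range_succ, ih]
    rcases Nat.mod_two_eq_zero_or_one n with h | h
    · rw [if_pos h, show (n + 1 + 1) / 2 = (n + 1) / 2 + 1 by omega]; ring
    · rw [if_neg (by omega), show (n + 1 + 1) / 2 = (n + 1) / 2 by omega]; ring

theorem prod_last (n : ℕ) :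
    ∏ j ∈ range n, (if j % 2 ≠ n % 2 then (-X : Polynomial ℤ) else -1) =
    (-1) ^ n * X ^ ((n + 1) / 2) := by
  rw [← prod_alt, ← Finset.prod_range_reflect]
  refine Finset.prod_congr rfl fun j hj => ?_
  rw [Finset.mem_range] at hj
  refine if_congr ?_ rfl rfl
  omega

theorem wt_last (n : ℕ) (x : ℤ) (v : ℕ → ℤ) :
    wt (n + 1) (insF n x v) = wt n v * ∏ j ∈ range n, hh (v j) x j n := by
  unfold wt
  rw [Finset.prod_range_succ]
  congr 1
  · refine Finset.prod_congr rfl fun k hk => Finset.prod_congr rfl fun j hj => ?_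
    rw [Finset.mem_range] at hk hj
    simp [insF, hk, hj.trans hk]
  · refine Finset.prod_congr rfl fun j hj => ?_
    rw [Finset.mem_range] at hj
    simp [insF, hj]

theorem wt_first (n : ℕ) (x : ℤ) (v : ℕ → ℤ) :
    wt (n + 1) (insF 0 x v) = wt n v * ∏ k ∈ range n, hh x (v k) 0 (k + 1) := by
  unfold wt
  rw [Finset.prod_range_succ', ← Finset.prod_mul_distrib]
  simp only [Finset.range_zero, Finset.prod_empty, mul_one]
  refine Finset.prod_congr rfl fun k _ => ?_
  rw [Finset.prod_range_succ']
  congr 1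
  refine Finset.prod_congr rfl fun j _ => ?_
  simp only [insF, hh]
  simp only [Nat.not_lt_zero, if_false, Nat.add_sub_cancel, Nat.add_eq_zero_iff, one_ne_zero,
    and_false]
  congr 1
  refine if_congr ?_ rfl rfl
  omega

theorem wt_last_pos {n : ℕ} (σ : SP n) : wt (n + 1) (insF n (n + 1) (vv σ)) = wt n (vv σ) := by
  rw [wt_last, Finset.prod_eq_one, mul_one]
  intro j hj
  rw [Finset.mem_range] at hj
  have := abs_le.1 (vv_abs_le σ j hj)
  have e : cnt (vv σ j) (n + 1) = 0 := by
    unfold cnt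
    rw [if_neg (by omega), if_neg (by omega)]
  rw [hh, e, pow_zero]

theorem wt_last_neg {n : ℕ} (σ : SP n) :
    wt (n + 1) (insF n (-(n + 1 : ℤ)) (vv σ)) = wt n (vv σ) * (X ^ ((n + 1) / 2)) ^ 2 := by
  rw [wt_last]
  congr 1
  have : (X ^ ((n + 1) / 2) : Polynomial ℤ) ^ 2 = ((-1) ^ n * X ^ ((n + 1) / 2)) ^ 2 := by
    rw [mul_pow, ← pow_mul (-1 : Polynomial ℤ), mul_comm n 2, pow_mul]; simp
  rw [this, ← prod_last, ← Finset.prod_pow]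
  refine Finset.prod_congr rfl fun j hj => ?_
  rw [Finset.mem_range] at hj
  have := abs_le.1 (vv_abs_le σ j hj)
  have e : cnt (vv σ j) (-(n + 1 : ℤ)) = 2 := by
    unfold cnt
    rw [if_pos (by omega), if_pos (by omega)]
  rw [hh, e]

theorem wt_first_both {n : ℕ} (σ : SP n) (b : Bool) :
    wt (n + 1) (insF 0 (if b then -(n + 1 : ℤ) else (n + 1 : ℤ)) (vv σ)) =
      wt n (vv σ) * ((-1) ^ n * X ^ ((n + 1) / 2)) := by
  rw [wt_first, ← prod_alt]
  congr 1
  refine Finset.prod_congr rfl fun j hj => ?_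
  rw [Finset.mem_range] at hj
  have := abs_le.1 (vv_abs_le σ j hj)
  have e : cnt (if b then -(n + 1 : ℤ) else (n + 1 : ℤ)) (vv σ j) = 1 := by
    unfold cnt
    cases b
    · simp only [Bool.false_eq_true, if_false]
      rw [if_pos (by omega), if_neg (by omega)]
    · simp only [if_true]
      rw [if_neg (by omega), if_pos (by omega)]
  rw [hh, e, pow_one]
  refine if_congr ?_ rfl rfl
  omega

open Classical in
noncomputable def AA (n p : ℕ) (P : (ℕ → ℤ) → Prop) : Polynomial ℤ :=
  ∑ b : Bool, ∑ σ : SP n,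
    if P (insF p (if b then -(n + 1 : ℤ) else (n + 1 : ℤ)) (vv σ)) then
      wt (n + 1) (insF p (if b then -(n + 1 : ℤ) else (n + 1 : ℤ)) (vv σ)) else 0

theorem SS_AA (n : ℕ) (P : (ℕ → ℤ) → Prop) :
    SS (n + 1) P = ∑ p ∈ range (n + 1), AA n p P := by
  classical
  rw [Finset.sum_range]
  exact sum_ins n (fun v => if P v then wt (n + 1) v else 0)

theorem AA_abs (n p : ℕ) (hp : p < n + 1) (P : (ℕ → ℤ) → Prop) :
    SS (n + 1) (fun v => |v p| = (n + 1 : ℕ) ∧ P v) = AA n p P := by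
  rw [SS_AA, Finset.sum_eq_single_of_mem p (Finset.mem_range.2 hp)]
  · unfold AA
    refine Finset.sum_congr rfl fun b _ => Finset.sum_congr rfl fun σ _ => ?_
    have : |insF p (if b then -(n + 1 : ℤ) else (n + 1 : ℤ)) (vv σ) p| = (n + 1 : ℕ) := by
      simp only [insF, lt_irrefl, if_false, if_true]
      split_ifs
      · rw [abs_neg, abs_of_nonneg (by positivity)]; simp
      · rw [abs_of_nonneg (by positivity)]; simp
    by_cases h : P (insF p (if b then -(n + 1 : ℤ) else (n + 1 : ℤ)) (vv σ))
    · rw [if_pos h, if_pos ⟨this, h⟩]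
    · rw [if_neg h, if_neg (fun h' => h h'.2)]
  · intro q hq hqp
    rw [Finset.mem_range] at hq
    unfold AA
    refine Finset.sum_eq_zero fun b _ => Finset.sum_eq_zero fun σ _ => ?_
    rw [if_neg]
    rintro ⟨h, -⟩
    unfold insF at h
    split_ifs at h with h1 h2 h2
    · have := vv_abs_le σ p (by omega); push_cast at h; omega
    · omega
    · omega
    · have := vv_abs_le σ (p - 1) (by omega); push_cast at h; omega

theorem rec_step (n : ℕ) (hn : 5 ≤ n) :
    SS (n + 1) (fun v => v 1 < v 2 ∧ v 3 < v 4) =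
      SS n (fun v => v 1 < v 2 ∧ v 3 < v 4) * (1 + (X ^ ((n + 1) / 2)) ^ 2) +
      SS n (fun v => v 0 < v 1 ∧ v 2 < v 3) * (2 * ((-1) ^ n * X ^ ((n + 1) / 2))) := by
  obtain ⟨m, rfl⟩ : ∃ m, n = m + 1 := ⟨n - 1, by omega⟩
  rw [SS_AA, Finset.sum_range_succ, Finset.sum_range_succ', Finset.sum_eq_zero, zero_add, add_comm]
  · congr 1
    · unfold AA SS
      rw [Fintype.sum_bool, add_comm, ← Finset.sum_add_distrib, Finset.sum_mul]
      refine Finset.sum_congr rfl fun σ _ => ?_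
      have e : ∀ x, (insF (m + 1) x (vv σ) 1 < insF (m + 1) x (vv σ) 2 ∧
          insF (m + 1) x (vv σ) 3 < insF (m + 1) x (vv σ) 4) ↔
          (vv σ 1 < vv σ 2 ∧ vv σ 3 < vv σ 4) := by
        intro x
        unfold insF
        rw [if_pos (by omega), if_pos (by omega), if_pos (by omega), if_pos (by omega)]
      by_cases h : vv σ 1 < vv σ 2 ∧ vv σ 3 < vv σ 4
      · rw [if_pos ((e _).2 h), if_pos ((e _).2 h), if_pos h]
        simp only [Bool.false_eq_true, if_false, if_true]
        rw [wt_last_pos, wt_last_neg]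
        ring
      · rw [if_neg (fun h' => h ((e _).1 h')), if_neg (fun h' => h ((e _).1 h')), if_neg h]
        simp
    · unfold AA SS
      rw [Fintype.sum_bool, add_comm, ← Finset.sum_add_distrib, Finset.sum_mul]
      refine Finset.sum_congr rfl fun σ _ => ?_
      have e : ∀ x, (insF 0 x (vv σ) 1 < insF 0 x (vv σ) 2 ∧
          insF 0 x (vv σ) 3 < insF 0 x (vv σ) 4) ↔
          (vv σ 0 < vv σ 1 ∧ vv σ 2 < vv σ 3) := by
        intro x
        simp [insF]
      by_cases h : vv σ 0 < vv σ 1 ∧ vv σ 2 < vv σ 3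
      · rw [if_pos ((e _).2 h), if_pos ((e _).2 h), if_pos h, wt_first_both, wt_first_both]
        ring
      · rw [if_neg (fun h' => h ((e _).1 h')), if_neg (fun h' => h ((e _).1 h')), if_neg h]
        simp
  · intro p hp
    rw [Finset.mem_range] at hp
    rw [← AA_abs _ _ (by omega)]
    exact mid_zero (m + 1 + 1) (p + 1) (by omega) (by omega) (by omega)

/-- The constraint at `i ≥ 2` next to the one at `0` can be moved to `1, 3`. -/
theorem move (n i : ℕ) (hi : 2 ≤ i) (hin : i + 1 < n) (hn : 5 ≤ n) :
    SS n (fun v => v 0 < v 1 ∧ v i < v (i + 1)) = SS n (fun v => v 1 < v 2 ∧ v 3 < v 4) := by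
  have st : ∀ i, 2 ≤ i → i + 2 < n → SS n (fun v => v 0 < v 1 ∧ v i < v (i + 1)) =
      SS n (fun v => v 0 < v 1 ∧ v (i + 1) < v (i + 1 + 1)) := by
    intro i hi hin
    exact SS_shift n i hin (fun v => v 0 < v 1) (by
      intro v
      rw [swo v i 0 (by omega) (by omega), swo v i 1 (by omega) (by omega)])
  have all : ∀ d, 2 + d + 1 < n → SS n (fun v => v 0 < v 1 ∧ v (2 + d) < v (2 + d + 1)) =
      SS n (fun v => v 0 < v 1 ∧ v 2 < v 3) := by
    intro d
    induction d with
    | zero => intro _; rfl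
    | succ d ih => intro h; rw [← ih (by omega)]; exact (st (2 + d) (by omega) (by omega)).symm
  obtain ⟨d, rfl⟩ : ∃ d, i = 2 + d := ⟨i - 2, by omega⟩
  rw [all d hin, ← all 1 (by omega)]
  have := SS_shift n 0 (by omega) (fun v => v 3 < v 4) (by
      intro v
      rw [swo v 0 3 (by omega) (by omega), swo v 0 4 (by omega) (by omega)])
  rw [SS_congr n _ (fun v => v 3 < v 4 ∧ v 0 < v (0 + 1)), this]
  · apply SS_congr; intro σ; simp only [Nat.zero_add]; tauto
  · intro σ; simp only [Nat.zero_add, Nat.reduceAdd]; tauto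

theorem main_prod (n : ℕ) (hn : 5 ≤ n) : SS n (fun v => v 1 < v 2 ∧ v 3 < v 4) =
    2 * ∏ j ∈ Finset.Icc 4 n, (1 + (-1 : Polynomial ℤ) ^ (j - 1) * X ^ (j / 2)) ^ 2 := by
  induction n, hn using Nat.le_induction with
  | base =>
    rw [base5, Finset.prod_Icc_succ_top (by omega), Finset.Icc_self, Finset.prod_singleton]
    norm_num
    ring
  | succ n hn ih =>
    rw [rec_step n hn, Finset.prod_Icc_succ_top (by omega),
      ← mul_assoc 2 (∏ j ∈ Finset.Icc 4 n, (1 + (-1 : Polynomial ℤ) ^ (j - 1) * X ^ (j / 2)) ^ 2),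
      ← ih, move n 2 le_rfl (by omega) hn, Nat.add_sub_cancel]
    have : ((-1 : Polynomial ℤ) ^ n) ^ 2 = 1 := by
      rw [← pow_mul, mul_comm, pow_mul]; simp
    linear_combination (-(SS n (fun v => v 1 < v 2 ∧ v 3 < v 4)) * (X ^ ((n + 1) / 2)) ^ 2) * this

/-! ### Relating to `genD` -/

theorem wt_congr (n : ℕ) (v w : ℕ → ℤ)
    (h : ∀ j k, j < k → k < n → cnt (v j) (v k) = cnt (w j) (w k)) : wt n v = wt n w := by
  unfold wt
  refine Finset.prod_congr rfl fun k hk => Finset.prod_congr rfl fun j hj => ?_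
  rw [Finset.mem_range] at hk hj
  rw [hh, hh, h j k hj hk]

/-- flip the sign at position `p` -/
def flipAt {n : ℕ} (p : Fin n) (s : Fin n → Bool) : Fin n → Bool :=
  Function.update s p (!s p)

theorem flipAt_flipAt {n : ℕ} (p : Fin n) (s : Fin n → Bool) : flipAt p (flipAt p s) = s := by
  simp [flipAt]

def flipPos {n : ℕ} (p : Fin n) : SP n ≃ SP n where
  toFun σ := (σ.1, flipAt p σ.2)
  invFun σ := (σ.1, flipAt p σ.2)
  left_inv σ := by simp [flipAt_flipAt]
  right_inv σ := by simp [flipAt_flipAt]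

def flipVal {n : ℕ} (q : Fin n) : SP n ≃ SP n where
  toFun σ := (σ.1, flipAt (σ.1.symm q) σ.2)
  invFun σ := (σ.1, flipAt (σ.1.symm q) σ.2)
  left_inv σ := by simp [flipAt_flipAt]
  right_inv σ := by simp [flipAt_flipAt]

theorem vv_flip {n : ℕ} (π : Equiv.Perm (Fin n)) (s : Fin n → Bool) (p : Fin n) (j : ℕ) :
    vv ((π, flipAt p s) : SP n) j = if j = p then - vv ((π, s) : SP n) j else vv ((π, s) : SP n) j := by
  by_cases hj : j < n
  · rw [vv_lt _ _ hj, vv_lt _ _ hj]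
    by_cases h : j = p
    · have : (⟨j, hj⟩ : Fin n) = p := Fin.ext h
      rw [if_pos h, this]
      simp only [flipAt, Function.update_self]
      by_cases hs : s p = true <;> simp [hs]
    · have : (⟨j, hj⟩ : Fin n) ≠ p := fun e => h (by rw [← e])
      rw [if_neg h]
      simp only [flipAt, Function.update_of_ne this]
  · rw [vv_ge _ _ (by omega), vv_ge _ _ (by omega)]
    simp

theorem flip_first (n i : ℕ) (hi : 2 ≤ i) (hn : 2 ≤ n) :
    SS n (fun v => -v 1 < v 0 ∧ v i < v (i + 1)) = SS n (fun v => v 0 < v 1 ∧ v i < v (i + 1)) := by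
  unfold SS
  rw [← (flipPos (⟨0, by omega⟩ : Fin n)).sum_comp]
  refine Finset.sum_congr rfl fun σ _ => ?_
  have e : ∀ j, vv (flipPos (⟨0, by omega⟩ : Fin n) σ) j = if j = 0 then - vv σ j else vv σ j :=
    fun j => vv_flip σ.1 σ.2 _ j
  have hw : wt n (vv (flipPos (⟨0, by omega⟩ : Fin n) σ)) = wt n (vv σ) := by
    apply wt_congr
    intro j k hjk hk
    rw [e, e, if_neg (by omega : ¬ k = 0)]
    split_ifs
    · unfold cnt; grind
    · rfl
  rw [hw]
  have : (-vv (flipPos (⟨0, by omega⟩ : Fin n) σ) 1 < vv (flipPos (⟨0, by omega⟩ : Fin n) σ) 0 ∧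
      vv (flipPos (⟨0, by omega⟩ : Fin n) σ) i < vv (flipPos (⟨0, by omega⟩ : Fin n) σ) (i + 1)) ↔
      (-vv σ 1 < -vv σ 0 ∧ vv σ i < vv σ (i + 1)) := by
    rw [e, e, e, e, if_neg (by omega), if_pos rfl, if_neg (by omega), if_neg (by omega)]
  have this := this.trans (show (-vv σ 1 < -vv σ 0 ∧ vv σ i < vv σ (i + 1)) ↔
    (vv σ 0 < vv σ 1 ∧ vv σ i < vv σ (i + 1)) by constructor <;> intro h <;> constructor <;> omega)
  by_cases h : (vv σ 0 < vv σ 1 ∧ vv σ i < vv σ (i + 1))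
  · rw [if_pos h, if_pos (this.2 h)]
  · rw [if_neg h, if_neg (fun h' => h (this.1 h'))]

theorem even_flip {n : ℕ} (π : Equiv.Perm (Fin n)) (s : Fin n → Bool) (p : Fin n) :
    IsEvenSP ((π, flipAt p s) : SP n) ↔ ¬ IsEvenSP ((π, s) : SP n) := by
  unfold IsEvenSP
  simp only
  have h1 : ∀ t : Fin n → Bool, (Finset.univ.filter (fun i => t i = true)).card =
      (if t p then 1 else 0) + ∑ i ∈ Finset.univ.erase p, if t i then 1 else 0 := by
    intro t
    rw [Finset.card_filter, ← Finset.add_sum_erase _ _ (Finset.mem_univ p)]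
  rw [h1, h1 s]
  have h2 : ∑ i ∈ Finset.univ.erase p, (if flipAt p s i then 1 else 0) =
      ∑ i ∈ Finset.univ.erase p, if s i then 1 else 0 := by
    refine Finset.sum_congr rfl fun i hi => ?_
    rw [flipAt, Function.update_of_ne (Finset.ne_of_mem_erase hi)]
  rw [h2, flipAt, Function.update_self]
  cases s p <;> simp [Nat.even_add_one, Nat.add_comm 1]

theorem cnt_one (x y : ℤ) (hx : |x| = 1) (hy : 1 < |y|) :
    cnt (-x) y = cnt x y ∧ cnt y (-x) = cnt y x := by
  unfold cnt; grind

theorem gen_double (n i : ℕ) (hn : 5 ≤ n) (hi : 2 ≤ i) (hin : i + 1 < n) :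
    2 * (∑ σ ∈ Finset.univ.filter (fun σ : SP n => IsEvenSP σ ∧
        (-vv σ 1 < vv σ 0 ∧ vv σ i < vv σ (i + 1))), wt n (vv σ)) =
      SS n (fun v => -v 1 < v 0 ∧ v i < v (i + 1)) := by
  have hflip : ∑ σ ∈ Finset.univ.filter (fun σ : SP n => IsEvenSP σ ∧
        (-vv σ 1 < vv σ 0 ∧ vv σ i < vv σ (i + 1))), wt n (vv σ) =
      ∑ σ ∈ Finset.univ.filter (fun σ : SP n => ¬ IsEvenSP σ ∧
        (-vv σ 1 < vv σ 0 ∧ vv σ i < vv σ (i + 1))), wt n (vv σ) := by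
    rw [Finset.sum_filter, Finset.sum_filter, ← (flipVal (⟨0, by omega⟩ : Fin n)).sum_comp]
    refine Finset.sum_congr rfl fun σ _ => ?_
    set z : Fin n := ⟨0, by omega⟩
    set p : Fin n := σ.1.symm z with hp
    have ev : IsEvenSP (flipVal z σ) ↔ ¬ IsEvenSP σ := even_flip σ.1 σ.2 p
    have e : ∀ j, vv (flipVal z σ) j = if j = p then - vv σ j else vv σ j :=
      fun j => vv_flip σ.1 σ.2 p j
    have hone : |vv σ p| = 1 := by
      rw [vv_abs σ p p.2]
      simp [hp, z]
    have hgt : ∀ j, j < n → j ≠ p → 1 < |vv σ j| := by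
      intro j hj hne
      have h1 := vv_abs_ne σ j p hj p.2 hne
      rw [hone] at h1
      rw [vv_abs σ j hj] at h1 ⊢
      omega
    have hc : ∀ j k, j ≠ k → j < n → k < n →
        cnt (vv (flipVal z σ) j) (vv (flipVal z σ) k) = cnt (vv σ j) (vv σ k) := by
      intro j k hjk hj hk
      rw [e, e]
      by_cases h1 : j = p
      · rw [if_pos h1, if_neg (by omega)]
        exact (cnt_one _ _ (by rw [h1, hone]) (hgt k hk (by omega))).1
      · rw [if_neg h1]
        by_cases h2 : k = p
        · rw [if_pos h2]
          exact (cnt_one _ _ (by rw [h2, hone]) (hgt j hj (by omega))).2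
        · rw [if_neg h2]
    have hw : wt n (vv (flipVal z σ)) = wt n (vv σ) :=
      wt_congr n _ _ fun j k hjk hk => hc j k (by omega) (by omega) hk
    have key : ∀ j k, j ≠ k → j < n → k < n →
        (vv (flipVal z σ) j < vv (flipVal z σ) k ↔ vv σ j < vv σ k) ∧
        (-vv (flipVal z σ) j < vv (flipVal z σ) k ↔ -vv σ j < vv σ k) := by
      intro j k hjk hj hk
      rw [e, e]
      have a := hgt j hj
      have b := hgt k hk
      by_cases h1 : j = p
      · rw [if_pos h1, if_neg (by omega)]
        have c := b (by omega)
        have d : |vv σ j| = 1 := by rw [h1, hone]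
        clear * - c d
        grind
      · rw [if_neg h1]
        by_cases h2 : k = p
        · rw [if_pos h2]
          have c := a (by omega)
          have d : |vv σ k| = 1 := by rw [h2, hone]
          clear * - c d
          grind
        · rw [if_neg h2]; simp
    rw [hw]
    refine if_congr ?_ rfl rfl
    rw [ev, (key 1 0 (by omega) (by omega) (by omega)).2,
      (key i (i + 1) (by omega) (by omega) (by omega)).1]
  rw [two_mul]
  nth_rewrite 2 [hflip]
  unfold SS
  rw [Finset.sum_filter, Finset.sum_filter, ← Finset.sum_add_distrib]
  refine Finset.sum_congr rfl fun σ _ => ?_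
  by_cases h1 : IsEvenSP σ <;> by_cases h2 : -vv σ 1 < vv σ 0 ∧ vv σ i < vv σ (i + 1) <;>
    simp [h1, h2]

theorem sum_pairs (n : ℕ) (F : ℕ → ℕ → ℕ) :
    ∑ p ∈ pairs n, F p.1 p.2 = ∑ k ∈ range n, ∑ j ∈ range k, F (j + 1) (k + 1) := by
  rw [Finset.sum_sigma']
  symm
  refine Finset.sum_bij' (fun x _ => (x.2 + 1, x.1 + 1)) (fun p _ => ⟨p.2 - 1, p.1 - 1⟩)
    ?_ ?_ ?_ ?_ ?_
  · intro x hx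
    simp only [Finset.mem_sigma, Finset.mem_range] at hx
    simp only [pairs, Finset.mem_filter, Finset.mem_product, Finset.mem_Icc]
    omega
  · intro p hp
    simp only [pairs, Finset.mem_filter, Finset.mem_product, Finset.mem_Icc] at hp
    simp only [Finset.mem_sigma, Finset.mem_range]
    omega
  · intro x hx
    simp
  · intro p hp
    simp only [pairs, Finset.mem_filter, Finset.mem_product, Finset.mem_Icc] at hp
    ext <;> simp <;> omega
  · intro x hx
    rfl

theorem ellD_eq {n : ℕ} (σ : SP n) : ellD σ = ell n (vv σ) := by
  unfold ellD invSP nspSP ell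
  rw [Finset.card_filter, Finset.card_filter, ← Finset.sum_add_distrib,
    sum_pairs n (fun a b => (if sval σ b < sval σ a then 1 else 0) +
      (if sval σ a + sval σ b < 0 then 1 else 0))]
  rfl

theorem LD_eq {n : ℕ} (σ : SP n) : LD σ = oell n (vv σ) := by
  unfold LD oinvSP onspSP oell
  rw [Finset.card_filter, Finset.card_filter, ← Finset.sum_add_distrib,
    sum_pairs n (fun a b => (if sval σ b < sval σ a ∧ a % 2 ≠ b % 2 then 1 else 0) +
      (if sval σ a + sval σ b < 0 ∧ a % 2 ≠ b % 2 then 1 else 0))]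
  refine Finset.sum_congr rfl fun k _ => Finset.sum_congr rfl fun j _ => ?_
  by_cases h : j % 2 = k % 2
  · have h' : (j + 1) % 2 = (k + 1) % 2 := by omega
    simp [h, h']
  · have h' : (j + 1) % 2 ≠ (k + 1) % 2 := by omega
    have hc : cnt (vv σ j) (vv σ k) = (if sval σ (k + 1) < sval σ (j + 1) then 1 else 0) +
      (if sval σ (j + 1) + sval σ (k + 1) < 0 then 1 else 0) := rfl
    rw [if_pos h, hc]
    by_cases h1 : sval σ (k + 1) < sval σ (j + 1) <;>
      by_cases h2 : sval σ (j + 1) + sval σ (k + 1) < 0 <;> simp [h1, h2, h']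

/-- Conjecture 1.3 (first part), proved in the paper: for `n ≥ 5` and `3 ≤ i ≤ n-1`,
`D_n^{{0,i}}(x) = ∏_{j=4}^{n} (1 + (-1)^{j-1} x^{⌊j/2⌋})²`. -/
theorem stmt13 (n i : ℕ) (hn : 5 ≤ n) (hi : 3 ≤ i) (hi' : i ≤ n - 1) :
    genD n {0, i} =
      ∏ j ∈ Finset.Icc 4 n, (1 + (-1 : Polynomial ℤ) ^ (j - 1) * X ^ (j / 2)) ^ 2 := by
  obtain ⟨k, rfl⟩ : ∃ k, i = k + 1 := ⟨i - 1, by omega⟩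
  have h1 : genD n {0, k + 1} = ∑ σ ∈ Finset.univ.filter (fun σ : SP n => IsEvenSP σ ∧
        (-vv σ 1 < vv σ 0 ∧ vv σ k < vv σ (k + 1))), wt n (vv σ) := by
    unfold genD
    refine Finset.sum_congr ?_ fun σ _ => by rw [wt_eq, ellD_eq, LD_eq]
    ext σ
    simp only [Finset.mem_filter, Finset.mem_univ, true_and]
    simp [InQuot, dval, vv]
  have h2 : 2 * genD n {0, k + 1} =
      2 * ∏ j ∈ Finset.Icc 4 n, (1 + (-1 : Polynomial ℤ) ^ (j - 1) * X ^ (j / 2)) ^ 2 := by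
    rw [h1, gen_double n k hn (by omega) (by omega), flip_first n k (by omega) (by omega),
      move n k (by omega) (by omega) hn, main_prod n hn]
  exact mul_left_cancel₀ two_ne_zero h2

end OddLength
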